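/- Let G be a finite simple connected graph. Then gp_o(G) ≥ s(G), i.e., the set of simplicial vertices of G is an outer general position set. -/

import Mathlib

open SimpleGraph

variable {V : Type*}

/-- Two vertices `x` and `y` are `Z`-positionable in `G` if no shortest `x,y`-path
contains a vertex of `Z` as an internal vertex. -/
def ZPositionable (G : SimpleGraph V) (Z : Set V) (x y : V) : Prop :=
  ∀ p : G.Walk x y, p.IsPath → p.length = G.dist x y →
    ∀ z ∈ Z, z ∈ p.support → z = x ∨ z = y

/-- `Z` is a total general position set of `G`: every pair of vertices of `G`
is `Z`-positionable. -/
def IsTotalGPSet (G : SimpleGraph V) (Z : Set V) : Prop :=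
  ∀ x y : V, ZPositionable G Z x y

/-- `Z` is an outer general position set of `G`: every pair of vertices of `Z`
is `Z`-positionable, and every `u ∈ Z`, `v ∉ Z` are `Z`-positionable. -/
def IsOuterGPSet (G : SimpleGraph V) (Z : Set V) : Prop :=
  ∀ x ∈ Z, ∀ y : V, ZPositionable G Z x y

/-- `Z` is a dual general position set of `G`: every pair of vertices of `Z`
is `Z`-positionable, and every pair of vertices outside `Z` is `Z`-positionable. -/
def IsDualGPSet (G : SimpleGraph V) (Z : Set V) : Prop :=
  (∀ x ∈ Z, ∀ y ∈ Z, ZPositionable G Z x y) ∧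
  (∀ x ∉ Z, ∀ y ∉ Z, ZPositionable G Z x y)

/-- The total general position number of `G`. -/
noncomputable def gpt (G : SimpleGraph V) : ℕ :=
  sSup {n | ∃ Z : Set V, IsTotalGPSet G Z ∧ Z.ncard = n}

/-- The outer general position number of `G`. -/
noncomputable def gpo (G : SimpleGraph V) : ℕ :=
  sSup {n | ∃ Z : Set V, IsOuterGPSet G Z ∧ Z.ncard = n}

/-- The dual general position number of `G`. -/
noncomputable def gpd (G : SimpleGraph V) : ℕ :=
  sSup {n | ∃ Z : Set V, IsDualGPSet G Z ∧ Z.ncard = n}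

/-- A vertex `x` is simplicial in `G` if its neighborhood induces a complete subgraph. -/
def IsSimplicial (G : SimpleGraph V) (x : V) : Prop :=
  ∀ u v : V, G.Adj x u → G.Adj x v → u ≠ v → G.Adj u v

/-- `u` is maximally distant from `v` in `G`. -/
def MaxDistantFrom (G : SimpleGraph V) (u v : V) : Prop :=
  ∀ w : V, G.Adj u w → G.dist w v ≤ G.dist u v

/-- `u` and `v` are mutually maximally distant (MMD) in `G`. -/
def MutuallyMaximallyDistant (G : SimpleGraph V) (u v : V) : Prop :=
  MaxDistantFrom G u v ∧ MaxDistantFrom G v u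

/-- An interior simplicial vertex of a walk can be bypassed, so it lies on no geodesic. -/
theorem IsSimplicial.eq_or_eq_of_mem_support {G : SimpleGraph V} {x y z : V}
    (hz : IsSimplicial G z) (p : G.Walk x y) (hp : p.length = G.dist x y)
    (hzp : z ∈ p.support) : z = x ∨ z = y := by
  obtain ⟨q, r, rfl⟩ := Walk.mem_support_iff_exists_append.mp hzp
  cases r with
  | nil => exact Or.inr rfl
  | @cons _ b _ hb r =>
    obtain ⟨q, rfl⟩ : ∃ q' : G.Walk z x, q = q'.reverse := ⟨q.reverse, by simp⟩
    cases q with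
    | nil => exact Or.inl rfl
    | @cons _ a _ ha q =>
      exfalso
      simp only [Walk.length_append, Walk.length_reverse, Walk.length_cons] at hp
      by_cases hab : a = b
      · subst hab
        have h := G.dist_le (q.reverse.append r)
        simp only [Walk.length_append, Walk.length_reverse] at h
        omega
      · have h := G.dist_le (q.reverse.append (Walk.cons (hz a b ha hb hab) r))
        simp only [Walk.length_append, Walk.length_reverse, Walk.length_cons] at h
        omega

theorem isTotalGPSet_setOf_isSimplicial (G : SimpleGraph V) :
    IsTotalGPSet G {z : V | IsSimplicial G z} :=
  fun _ _ p _ hp _ hz hzp => IsSimplicial.eq_or_eq_of_mem_support hz p hp hzp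

theorem IsTotalGPSet.isOuterGPSet {G : SimpleGraph V} {Z : Set V} (h : IsTotalGPSet G Z) :
    IsOuterGPSet G Z :=
  fun x _ y => h x y

theorem IsOuterGPSet.ncard_le_gpo [Finite V] {G : SimpleGraph V} {Z : Set V}
    (h : IsOuterGPSet G Z) : Z.ncard ≤ gpo G := by
  refine le_csSup ⟨Nat.card V, ?_⟩ ⟨Z, h, rfl⟩
  rintro _ ⟨W, -, rfl⟩
  exact Set.ncard_le_card W

/-- For a finite connected graph `G`, the set of simplicial
vertices of `G` is an outer general position set, and `gp_o(G) ≥ s(G)`. -/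
theorem gpo_ge_simplicialCount [Fintype V] (G : SimpleGraph V) (hG : G.Connected) :
    IsOuterGPSet G {z : V | IsSimplicial G z} ∧
    {z : V | IsSimplicial G z}.ncard ≤ gpo G := by
  have h := (isTotalGPSet_setOf_isSimplicial G).isOuterGPSet
  exact ⟨h, h.ncard_le_gpo⟩
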